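/- arXiv:0907.2566 — 9 statements merged into one kernel-verified Lean document; each statement's English description precedes it below -/
import Mathlib

section
/- In any 2-crossed module of groups (L, E, G, δ, ∂, ▷, {,}), for all e, f ∈ E the following three formulas for the inverse of the Peiffer lifting hold: {e,f}⁻¹ = ∂(e) ▷ {e⁻¹, e f e⁻¹}; {e,f}⁻¹ = (e f e⁻¹) ▷′ {e, f⁻¹}; and {e,f}⁻¹ = (∂(e) ▷ f) ▷′ {e, f⁻¹}. -/
/-- A 2-crossed module of groups `(L, E, G, δ, ∂, ▷, {,})`.
`dl` is δ : L → E, `de` is ∂ : E → G, `actL`/`actE` are the left actions of `G`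
on `L` and `E` by group automorphisms, and `pl` is the Peiffer lifting. -/
structure TwoCrossedModule (L E G : Type*) [Group L] [Group E] [Group G] where
  /-- δ : L → E -/
  dl : L →* E
  /-- ∂ : E → G -/
  de : E →* G
  /-- the action of G on L by automorphisms -/
  actL : G →* MulAut L
  /-- the action of G on E by automorphisms -/
  actE : G →* MulAut E
  /-- the Peiffer lifting {,} : E × E → L -/
  pl : E → E → L
  comp_triv : ∀ l : L, de (dl l) = 1
  dl_equiv : ∀ (a : G) (l : L), dl (actL a l) = actE a (dl l)
  de_equiv : ∀ (a : G) (e : E), de (actE a e) = a * de e * a⁻¹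
  pl_equiv : ∀ (a : G) (e f : E), actL a (pl e f) = pl (actE a e) (actE a f)
  ax_i : ∀ e f : E, dl (pl e f) = e * f * e⁻¹ * actE (de e) f⁻¹
  ax_ii : ∀ l k : L, pl (dl l) (dl k) = l * k * l⁻¹ * k⁻¹
  ax_iii : ∀ e f g : E, pl (e * f) g = pl e (f * g * f⁻¹) * actL (de e) (pl f g)
  ax_iv : ∀ e f g : E, pl e (f * g) =
    pl e f * pl e g * pl (e * g * e⁻¹ * actE (de e) g⁻¹)⁻¹ (actE (de e) f)
  ax_v : ∀ (e : E) (l : L), pl (dl l) e * pl e (dl l) = l * actL (de e) l⁻¹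

/-- The operation `e ▷′ l := l * {δ(l)⁻¹, e}`. -/
def TwoCrossedModule.tprime {L E G : Type*} [Group L] [Group E] [Group G]
    (M : TwoCrossedModule L E G) (e : E) (l : L) : L :=
  l * M.pl (M.dl l)⁻¹ e

namespace TwoCrossedModule

variable {L E G : Type*} [Group L] [Group E] [Group G] (M : TwoCrossedModule L E G)

theorem pl_one_left (g : E) : M.pl 1 g = 1 := by
  simpa using M.ax_iii 1 1 g

theorem pl_one_right (e : E) : M.pl e 1 = 1 := by
  simpa [M.pl_one_left] using M.ax_iv e 1 1

theorem pl_inv_eq_actL (e f : E) :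
    (M.pl e f)⁻¹ = M.actL (M.de e) (M.pl e⁻¹ (e * f * e⁻¹)) := by
  have h := M.ax_iii e e⁻¹ (e * f * e⁻¹)
  rw [mul_inv_cancel, M.pl_one_left,
    show e⁻¹ * (e * f * e⁻¹) * e⁻¹⁻¹ = f by group] at h
  exact inv_eq_of_mul_eq_one_right h.symm

theorem pl_inv_eq_tprime_actE (e f : E) :
    (M.pl e f)⁻¹ = M.tprime (M.actE (M.de e) f) (M.pl e f⁻¹) := by
  have h := M.ax_iv e f f⁻¹
  rw [mul_inv_cancel, M.pl_one_right, ← M.ax_i, mul_assoc] at h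
  exact inv_eq_of_mul_eq_one_right h.symm

theorem tprime_mul_dl_self (a : E) (x : L) :
    M.tprime (a * M.dl x) x = M.tprime a x := by
  have hx : M.pl (M.dl x)⁻¹ (M.dl x) = 1 := by
    rw [← map_inv, M.ax_ii]
    group
  have h := M.ax_iv (M.dl x)⁻¹ a (M.dl x)
  simp only [hx, M.comp_triv, map_one, MulAut.one_apply, map_inv, inv_mul_cancel, one_mul,
    inv_inv, mul_inv_cancel, inv_one, M.pl_one_left, mul_one] at h
  rw [tprime, tprime, h]

end TwoCrossedModule

/-- Three formulas for the inverse of the Peiffer lifting: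
`{e,f}⁻¹ = ∂(e) ▷ {e⁻¹, e f e⁻¹}`, `{e,f}⁻¹ = (e f e⁻¹) ▷′ {e, f⁻¹}` and
`{e,f}⁻¹ = (∂(e) ▷ f) ▷′ {e, f⁻¹}`. -/
theorem peiffer_lifting_inverses {L E G : Type*} [Group L] [Group E] [Group G]
    (M : TwoCrossedModule L E G) :
    ∀ e f : E,
      (M.pl e f)⁻¹ = M.actL (M.de e) (M.pl e⁻¹ (e * f * e⁻¹)) ∧
      (M.pl e f)⁻¹ = M.tprime (e * f * e⁻¹) (M.pl e f⁻¹) ∧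
      (M.pl e f)⁻¹ = M.tprime (M.actE (M.de e) f) (M.pl e f⁻¹) := by
  intro e f
  refine ⟨M.pl_inv_eq_actL e f, ?_, M.pl_inv_eq_tprime_actE e f⟩
  rw [← M.tprime_mul_dl_self, M.ax_i, M.pl_inv_eq_tprime_actE]
  congr 1
  group
end

section
/- In any 2-crossed module of groups (L, E, G, δ, ∂, ▷, {,}), for all e, f, g ∈ E one has {e f, g} = (e ▷′ {f, g}) · {e, ∂(f) ▷ g}. -/
namespace TwoCrossedModule

variable {L E G : Type*} [Group L] [Group E] [Group G] (M : TwoCrossedModule L E G)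

/-- The Peiffer lifting of a product whose first factor lies in the image of `δ`. -/
theorem pl_dl_mul (e : E) (l : L) (h : E) :
    M.pl e (M.dl l * h) =
      M.pl e (M.dl l) * M.actL (M.de e) l * M.pl e h * (M.actL (M.de e) l)⁻¹ := by
  rw [M.ax_iv, ← M.ax_i, ← M.dl_equiv, ← map_inv, M.ax_ii]
  group

/-- The operation `▷′` expressed through the lifting with `δ` in the second argument. -/
theorem tprime_eq_pl_dl_mul (e : E) (l : L) :
    M.tprime e l = M.pl e (M.dl l) * M.actL (M.de e) l := by
  have h₁ := M.ax_v e l⁻¹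
  have h₂ := M.pl_dl_mul e l (M.dl l)⁻¹
  rw [mul_inv_cancel, M.pl_one_right] at h₂
  rw [map_inv, inv_inv] at h₁
  rw [tprime, eq_mul_inv_of_mul_eq h₁, eq_mul_inv_of_mul_eq (mul_inv_eq_one.mp h₂.symm)]
  group

end TwoCrossedModule

/-- For all `e, f, g ∈ E`, `{e f, g} = (e ▷′ {f, g}) · {e, ∂(f) ▷ g}`. -/
theorem pl_mul_left {L E G : Type*} [Group L] [Group E] [Group G]
    (M : TwoCrossedModule L E G) :
    ∀ e f g : E,
      M.pl (e * f) g = M.tprime e (M.pl f g) * M.pl e (M.actE (M.de f) g) := by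
  intro e f g
  have h : f * g * f⁻¹ = M.dl (M.pl f g) * M.actE (M.de f) g := by
    simp [M.ax_i]
  rw [M.ax_iii, h, M.pl_dl_mul, M.tprime_eq_pl_dl_mul, inv_mul_cancel_right]
end

section
/- In any 2-crossed module of groups (L, E, G, δ, ∂, ▷, {,}), for all e, f, g ∈ E one has both {e, f g} = {e, f} · ((∂(e) ▷ f) ▷′ {e, g}) and {e, f g} = ((e f e⁻¹) ▷′ {e, g}) · {e, f}. -/
namespace TwoCrossedModule

variable {L E G : Type*} [Group L] [Group E] [Group G] (M : TwoCrossedModule L E G)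

/-- The Peiffer lifting of a product in its second argument, with the bracket of axiom (iv)
written as the image of a Peiffer lifting under `δ`. -/
theorem pl_mul_dl (e f g : E) :
    M.pl e (f * g) = M.pl e f * M.pl e g * M.pl (M.dl (M.pl e g))⁻¹ (M.actE (M.de e) f) := by
  rw [M.ax_iv, M.ax_i]

/-- Acting by `δ(y) h` is acting by `h` followed by conjugation by `y`. -/
theorem tprime_dl_mul (y x : L) (h : E) :
    M.tprime (M.dl y * h) x = y * M.tprime h x * y⁻¹ := by
  have hde : M.de (M.dl x)⁻¹ = 1 := by rw [map_inv, M.comp_triv, inv_one]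
  simp only [tprime]
  rw [pl_mul_dl, hde, map_one, MulAut.one_apply]
  generalize M.pl (M.dl x)⁻¹ h = k
  rw [← map_inv, ← map_inv, M.ax_ii, M.ax_ii]
  group

end TwoCrossedModule

/-- For all `e, f, g ∈ E`, both `{e, f g} = {e, f} · ((∂(e) ▷ f) ▷′ {e, g})`
and `{e, f g} = ((e f e⁻¹) ▷′ {e, g}) · {e, f}` hold. -/
theorem pl_mul_right {L E G : Type*} [Group L] [Group E] [Group G]
    (M : TwoCrossedModule L E G) :
    ∀ e f g : E,
      M.pl e (f * g) = M.pl e f * M.tprime (M.actE (M.de e) f) (M.pl e g) ∧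
      M.pl e (f * g) = M.tprime (e * f * e⁻¹) (M.pl e g) * M.pl e f := by
  intro e f g
  have h₁ : M.pl e (f * g) = M.pl e f * M.tprime (M.actE (M.de e) f) (M.pl e g) := by
    rw [M.pl_mul_dl, mul_assoc, TwoCrossedModule.tprime]
  refine ⟨h₁, ?_⟩
  have hconj : e * f * e⁻¹ = M.dl (M.pl e f) * M.actE (M.de e) f := by
    rw [M.ax_i, map_inv, inv_mul_cancel_right]
  rw [h₁, hconj, M.tprime_dl_mul, inv_mul_cancel_right]
end

section
/- In any 2-crossed module of groups (L, E, G, δ, ∂, ▷, {,}), the operation e ▷′ l := l {δ(l)⁻¹, e} is a left action of E on L by group automorphisms, and together with δ : L → E it forms a crossed module; explicitly, for all e, f ∈ E and l, k ∈ L: e ▷′ (l k) = (e ▷′ l)(e ▷′ k); (e f) ▷′ l = e ▷′ (f ▷′ l); 1 ▷′ l = l; δ(e ▷′ l) = e δ(l) e⁻¹; and δ(l) ▷′ k = l k l⁻¹. -/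
namespace TwoCrossedModule

variable {L E G : Type*} [Group L] [Group E] [Group G] (M : TwoCrossedModule L E G)

theorem dl_pl_dl (l : L) (e : E) :
    M.dl (M.pl (M.dl l) e) = M.dl l * e * (M.dl l)⁻¹ * e⁻¹ := by
  simp [M.ax_i, M.comp_triv]

theorem dl_tprime (e : E) (l : L) : M.dl (M.tprime e l) = e * M.dl l * e⁻¹ := by
  rw [tprime, map_mul, ← map_inv, dl_pl_dl, map_inv]
  group

theorem tprime_dl (l k : L) : M.tprime (M.dl l) k = l * k * l⁻¹ := by
  rw [tprime, ← map_inv, M.ax_ii]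
  group

theorem tprime_one (l : L) : M.tprime 1 l = l := by
  simpa using M.tprime_dl 1 l

theorem tprime_eq_actL_mul (e : E) (l : L) :
    M.tprime e l = M.actL (M.de e) l * (M.pl e (M.dl l)⁻¹)⁻¹ := by
  have h := M.ax_v e l⁻¹
  rw [inv_inv] at h
  rw [tprime, ← map_inv, eq_mul_inv_iff_mul_eq, mul_assoc, h, mul_inv_cancel_left]

theorem tprime_mul (e : E) (l k : L) :
    M.tprime e (l * k) = M.tprime e l * M.tprime e k := by
  have h := M.ax_iv e (M.dl k)⁻¹ (M.dl l)⁻¹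
  rw [← M.ax_i, ← map_inv M.dl (M.pl _ _), ← map_inv M.dl k, ← M.dl_equiv, M.ax_ii] at h
  simp only [tprime_eq_actL_mul, map_mul, mul_inv_rev]
  rw [← map_inv M.dl k, h, map_inv (M.actL _)]
  group

/-- The Peiffer lifting on the image of `δ` is a crossed homomorphism in its second variable. -/
theorem pl_dl_mul_s7 (m : L) (e f : E) :
    M.pl (M.dl m) (e * f) = M.pl (M.dl m) e * M.tprime e (M.pl (M.dl m) f) := by
  rw [M.ax_iv, ← M.ax_i, tprime, M.comp_triv, map_one, MulAut.one_apply, mul_assoc]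

theorem mul_tprime (e f : E) (l : L) :
    M.tprime (e * f) l = M.tprime e (M.tprime f l) := by
  conv_rhs => rw [tprime.eq_1 M f, tprime_mul, tprime]
  rw [tprime, ← map_inv, pl_dl_mul_s7, mul_assoc]

end TwoCrossedModule

/-- The operation `e ▷′ l := l {δ(l)⁻¹, e}` is a left action of `E` on `L` by
group automorphisms, and together with `δ : L → E` it forms a crossed module:
`e ▷′ (l k) = (e ▷′ l)(e ▷′ k)`, `(e f) ▷′ l = e ▷′ (f ▷′ l)`, `1 ▷′ l = l`,
`δ(e ▷′ l) = e δ(l) e⁻¹`, and `δ(l) ▷′ k = l k l⁻¹`. -/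
theorem tprime_crossed_module {L E G : Type*} [Group L] [Group E] [Group G]
    (M : TwoCrossedModule L E G) :
    ∀ (e f : E) (l k : L),
      M.tprime e (l * k) = M.tprime e l * M.tprime e k ∧
      M.tprime (e * f) l = M.tprime e (M.tprime f l) ∧
      M.tprime 1 l = l ∧
      M.dl (M.tprime e l) = e * M.dl l * e⁻¹ ∧
      M.tprime (M.dl l) k = l * k * l⁻¹ := by
  exact fun e f l k => ⟨M.tprime_mul e l k, M.mul_tprime e f l, M.tprime_one l,
    M.dl_tprime e l, M.tprime_dl l k⟩
end

section
/- In any 2-crossed module of groups (L, E, G, δ, ∂, ▷, {,}), the boundary of the interchange 3-cell is correct: for every X ∈ G and e, f ∈ E, δ( e ▷′ {e⁻¹, X ▷ f}⁻¹ )⁻¹ · e · ((∂(e)⁻¹ X) ▷ f) = (X ▷ f) · e. -/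
/-- The boundary map intertwines `▷′` with conjugation: `δ(e ▷′ l) = e δ(l) e⁻¹`. -/
theorem TwoCrossedModule.dl_tprime_s10 {L E G : Type*} [Group L] [Group E] [Group G]
    (M : TwoCrossedModule L E G) (e : E) (l : L) :
    M.dl (M.tprime e l) = e * M.dl l * e⁻¹ := by
  simp [tprime, M.ax_i, M.comp_triv, mul_assoc]

/-- The boundary of the interchange 3-cell is correct: for every `X ∈ G` and
`e, f ∈ E`, `δ(e ▷′ {e⁻¹, X ▷ f}⁻¹)⁻¹ · e · ((∂(e)⁻¹ X) ▷ f) = (X ▷ f) · e`. -/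
theorem interchange_boundary {L E G : Type*} [Group L] [Group E] [Group G]
    (M : TwoCrossedModule L E G) :
    ∀ (X : G) (e f : E),
      (M.dl (M.tprime e (M.pl e⁻¹ (M.actE X f))⁻¹))⁻¹ * e *
          M.actE ((M.de e)⁻¹ * X) f =
        M.actE X f * e := by
  intro X e f
  simp [M.dl_tprime_s10, M.ax_i, mul_assoc]
end

section
/- In any differential 2-crossed module (𝔩, 𝔢, 𝔤, δ, ∂, ▷, {,}), the action ▷′ of 𝔢 on 𝔩 is by derivations: for all u ∈ 𝔢 and x, y ∈ 𝔩, u ▷′ [x, y] = [u ▷′ x, y] + [x, u ▷′ y]. -/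
/-- A differential 2-crossed module `(𝔩, 𝔢, 𝔤, δ, ∂, ▷, {,})` of real Lie
algebras. `dl` is δ : 𝔩 → 𝔢, `pd` is ∂ : 𝔢 → 𝔤, `actL`/`actE` are the left
actions of `𝔤` on `𝔩` and `𝔢` by derivations, and `pl` is the Peiffer lifting. -/
structure DiffTwoCrossedModule (𝔩 𝔢 𝔤 : Type*)
    [LieRing 𝔩] [LieAlgebra ℝ 𝔩] [LieRing 𝔢] [LieAlgebra ℝ 𝔢]
    [LieRing 𝔤] [LieAlgebra ℝ 𝔤] where
  /-- δ : 𝔩 → 𝔢 -/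
  dl : 𝔩 →ₗ⁅ℝ⁆ 𝔢
  /-- ∂ : 𝔢 → 𝔤 -/
  pd : 𝔢 →ₗ⁅ℝ⁆ 𝔤
  /-- the action of 𝔤 on 𝔩 by derivations -/
  actL : 𝔤 →ₗ⁅ℝ⁆ LieDerivation ℝ 𝔩 𝔩
  /-- the action of 𝔤 on 𝔢 by derivations -/
  actE : 𝔤 →ₗ⁅ℝ⁆ LieDerivation ℝ 𝔢 𝔢
  /-- the Peiffer lifting {,} : 𝔢 × 𝔢 → 𝔩, a bilinear map -/
  pl : 𝔢 →ₗ[ℝ] 𝔢 →ₗ[ℝ] 𝔩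
  comp_triv : ∀ v : 𝔩, pd (dl v) = 0
  dl_equiv : ∀ (X : 𝔤) (x : 𝔩), dl (actL X x) = actE X (dl x)
  pd_equiv : ∀ (X : 𝔤) (v : 𝔢), pd (actE X v) = ⁅X, pd v⁆
  pl_equiv : ∀ (X : 𝔤) (u v : 𝔢),
    actL X (pl u v) = pl (actE X u) v + pl u (actE X v)
  ax_i : ∀ u v : 𝔢, dl (pl u v) = ⁅u, v⁆ - actE (pd u) v
  ax_ii : ∀ x y : 𝔩, pl (dl x) (dl y) = ⁅x, y⁆
  ax_iii : ∀ u v w : 𝔢, pl ⁅u, v⁆ w =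
    actL (pd u) (pl v w) + pl u ⁅v, w⁆ - actL (pd v) (pl u w) - pl v ⁅u, w⁆
  ax_iv : ∀ u v w : 𝔢, pl u ⁅v, w⁆ = pl (dl (pl u v)) w - pl (dl (pl u w)) v
  ax_v : ∀ (x : 𝔩) (v : 𝔢), pl (dl x) v + pl v (dl x) = -(actL (pd v) x)

/-- The operation `v ▷′ x := −{δ(x), v}`. -/
def DiffTwoCrossedModule.tprime {𝔩 𝔢 𝔤 : Type*}
    [LieRing 𝔩] [LieAlgebra ℝ 𝔩] [LieRing 𝔢] [LieAlgebra ℝ 𝔢]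
    [LieRing 𝔤] [LieAlgebra ℝ 𝔤] (M : DiffTwoCrossedModule 𝔩 𝔢 𝔤)
    (v : 𝔢) (x : 𝔩) : 𝔩 :=
  -(M.pl (M.dl x) v)

namespace DiffTwoCrossedModule

variable {𝔩 𝔢 𝔤 : Type*}
  [LieRing 𝔩] [LieAlgebra ℝ 𝔩] [LieRing 𝔢] [LieAlgebra ℝ 𝔢]
  [LieRing 𝔤] [LieAlgebra ℝ 𝔤] (M : DiffTwoCrossedModule 𝔩 𝔢 𝔤)

theorem dl_pl_dl (x : 𝔩) (v : 𝔢) : M.dl (M.pl (M.dl x) v) = ⁅M.dl x, v⁆ := by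
  simp [M.ax_i, M.comp_triv]

theorem pl_dl_lie (x y : 𝔩) (u : 𝔢) : M.pl (M.dl x) ⁅M.dl y, u⁆ = ⁅x, M.pl (M.dl y) u⁆ := by
  rw [← M.dl_pl_dl, M.ax_ii]

theorem pl_dl_lie_dl (x y : 𝔩) (u : 𝔢) :
    M.pl ⁅M.dl x, M.dl y⁆ u = ⁅M.pl (M.dl x) u, y⁆ + ⁅x, M.pl (M.dl y) u⁆ := by
  rw [M.ax_iii, M.comp_triv, M.comp_triv, M.pl_dl_lie, M.pl_dl_lie,
    ← lie_skew (M.pl (M.dl x) u) y]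
  simp only [map_zero, LieDerivation.coe_zero, Pi.zero_apply]
  abel

end DiffTwoCrossedModule

/-- In any differential 2-crossed module, the action `▷′` of `𝔢` on `𝔩` is by
derivations: `u ▷′ [x, y] = [u ▷′ x, y] + [x, u ▷′ y]`. -/
theorem tprime_is_derivation {𝔩 𝔢 𝔤 : Type*}
    [LieRing 𝔩] [LieAlgebra ℝ 𝔩] [LieRing 𝔢] [LieAlgebra ℝ 𝔢]
    [LieRing 𝔤] [LieAlgebra ℝ 𝔤] (M : DiffTwoCrossedModule 𝔩 𝔢 𝔤) :
    ∀ (u : 𝔢) (x y : 𝔩),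
      M.tprime u ⁅x, y⁆ = ⁅M.tprime u x, y⁆ + ⁅x, M.tprime u y⁆ := by
  intro u x y
  simp only [DiffTwoCrossedModule.tprime, LieHom.map_lie, M.pl_dl_lie_dl, neg_lie, lie_neg,
    neg_add]
end

section
/- Let V be a module over a commutative ring and ∂ : V → V a linear map with ∂ ∘ ∂ = 0. For linear maps s, t : V → V define s * t := s + t + s ∘ ∂ ∘ t + s ∘ t ∘ ∂ and β(s) := id + ∂ ∘ s + s ∘ ∂. Then the product * is associative, (s * t) * u = s * (t * u) for all linear s, t, u, and β respects the products: β(s * t) = β(s) ∘ β(t) for all linear s, t. -/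
variable {R V : Type*} [CommRing R] [AddCommGroup V] [Module R V]

/-- The product `s * t := s + t + s ∘ ∂ ∘ t + s ∘ t ∘ ∂` on linear endomorphisms
(the product of 1-homotopies of a chain complex). -/
def homotopyMul (pd s t : V →ₗ[R] V) : V →ₗ[R] V :=
  s + t + s ∘ₗ pd ∘ₗ t + s ∘ₗ t ∘ₗ pd

/-- The map `β(s) := id + ∂ ∘ s + s ∘ ∂`. -/
def homotopyBeta (pd s : V →ₗ[R] V) : V →ₗ[R] V :=
  LinearMap.id + pd ∘ₗ s + s ∘ₗ pd

/-- Let `V` be a module over a commutative ring and `∂ : V → V` linear with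
`∂ ∘ ∂ = 0`.  Then the product `s * t = s + t + s∂t + st∂` is associative and
`β(s) = id + ∂s + s∂` respects the products: `β(s * t) = β(s) ∘ β(t)`. -/
theorem homotopyMul_assoc_and_beta_mul (pd : V →ₗ[R] V)
    (h : ∀ v : V, pd (pd v) = 0) :
    (∀ s t u : V →ₗ[R] V,
      homotopyMul pd (homotopyMul pd s t) u = homotopyMul pd s (homotopyMul pd t u)) ∧
    (∀ s t : V →ₗ[R] V,
      homotopyBeta pd (homotopyMul pd s t) = homotopyBeta pd s ∘ₗ homotopyBeta pd t) := by
  constructor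
  · intro s t u
    ext v
    simp only [homotopyMul, LinearMap.add_apply, LinearMap.comp_apply, map_add, map_zero, h]
    abel
  · intro s t
    ext v
    simp only [homotopyMul, homotopyBeta, LinearMap.add_apply, LinearMap.comp_apply,
      LinearMap.id_apply, map_add, map_zero, h]
    abel
end

section
/- Let (∂ : 𝔢 → 𝔤, ▷) be a differential crossed module. If s, t : 𝔤 → 𝔢 are derivations (linear maps with s([X,Y]) = X ▷ s(Y) − Y ▷ s(X) for all X, Y ∈ 𝔤, and likewise for t), then [s, t] := s ∘ ∂ ∘ t − t ∘ ∂ ∘ s is again a derivation from 𝔤 to 𝔢, i.e. [s,t]([X,Y]) = X ▷ [s,t](Y) − Y ▷ [s,t](X) for all X, Y ∈ 𝔤. -/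
/-- Let `(∂ : 𝔢 → 𝔤, ▷)` be a differential crossed module: `pd` is a Lie
algebra map, `act` is an action of `𝔤` on `𝔢` by derivations, with
`∂(X ▷ v) = [X, ∂(v)]` and `∂(u) ▷ v = [u, v]`.  If `s, t : 𝔤 → 𝔢` are
derivations, then `[s, t] := s ∘ ∂ ∘ t − t ∘ ∂ ∘ s` is again a derivation. -/
theorem derivation_bracket_is_derivation
    {𝔢 𝔤 : Type*} [LieRing 𝔢] [LieAlgebra ℝ 𝔢] [LieRing 𝔤] [LieAlgebra ℝ 𝔤]
    (pd : 𝔢 →ₗ⁅ℝ⁆ 𝔤) (act : 𝔤 →ₗ⁅ℝ⁆ LieDerivation ℝ 𝔢 𝔢)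
    (hequiv : ∀ (X : 𝔤) (v : 𝔢), pd (act X v) = ⁅X, pd v⁆)
    (hpeiffer : ∀ u v : 𝔢, act (pd u) v = ⁅u, v⁆)
    (s t : 𝔤 →ₗ[ℝ] 𝔢)
    (hs : ∀ X Y : 𝔤, s ⁅X, Y⁆ = act X (s Y) - act Y (s X))
    (ht : ∀ X Y : 𝔤, t ⁅X, Y⁆ = act X (t Y) - act Y (t X)) :
    ∀ X Y : 𝔤,
      (s ∘ₗ pd.toLinearMap ∘ₗ t - t ∘ₗ pd.toLinearMap ∘ₗ s) ⁅X, Y⁆ =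
        act X ((s ∘ₗ pd.toLinearMap ∘ₗ t - t ∘ₗ pd.toLinearMap ∘ₗ s) Y) -
        act Y ((s ∘ₗ pd.toLinearMap ∘ₗ t - t ∘ₗ pd.toLinearMap ∘ₗ s) X) := by
  intro X Y
  simp only [LinearMap.sub_apply, LinearMap.comp_apply, LieHom.coe_toLinearMap, hs, ht,
    map_sub, hequiv, hpeiffer]
  rw [← lie_skew (s X) (t Y), ← lie_skew (s Y) (t X)]
  abel
end

section
/- Let (∂ : 𝔢 → 𝔤, ▷) be a differential crossed module. For derivations s, t : 𝔤 → 𝔢 set [s,t] := s ∘ ∂ ∘ t − t ∘ ∂ ∘ s and (X ▷ t)(Z) := X ▷ t(Z) − t([X,Z]) for X ∈ 𝔤. On pairs define the semidirect bracket [(X,s),(Y,t)] := ([X,Y], X ▷ t − Y ▷ s + [s,t]) and the action of β′(X,s) on (Y,t) as (f₁(Y), f₂ ∘ t − t ∘ f₁), where f₁(Z) := [X,Z] + ∂(s(Z)) and f₂(v) := X ▷ v + s(∂(v)). Then the Peiffer commutator is given by [(X,s),(Y,t)] − β′(X,s) ▷ (Y,t) = (−∂(s(Y)), −F_{s(Y)}),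 where F_e : 𝔤 → 𝔢 is defined by F_e(Z) := Z ▷ e; equivalently, its first component equals −∂(s(Y)) and its second component, evaluated at any Z ∈ 𝔤, equals −Z ▷ s(Y). -/
/-- Let `(∂ : 𝔢 → 𝔤, ▷)` be a differential crossed module.  For derivations
`s, t : 𝔤 → 𝔢` set `[s,t] := s ∘ ∂ ∘ t − t ∘ ∂ ∘ s` and
`(X ▷ t)(Z) := X ▷ t(Z) − t([X,Z])`.  On pairs, the semidirect bracket is
`[(X,s),(Y,t)] := ([X,Y], X ▷ t − Y ▷ s + [s,t])` and the action of
`β′(X,s)` on `(Y,t)` is `(f₁(Y), f₂ ∘ t − t ∘ f₁)`, where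
`f₁(Z) := [X,Z] + ∂(s(Z))` and `f₂(v) := X ▷ v + s(∂(v))`.  Then the Peiffer
commutator `[(X,s),(Y,t)] − β′(X,s) ▷ (Y,t)` equals `(−∂(s(Y)), −F_{s(Y)})`,
where `F_e(Z) := Z ▷ e`: its first component is `−∂(s(Y))` and its second
component, evaluated at any `Z`, is `−Z ▷ s(Y)`. -/
theorem automorphism_peiffer_pairing
    {𝔢 𝔤 : Type*} [LieRing 𝔢] [LieAlgebra ℝ 𝔢] [LieRing 𝔤] [LieAlgebra ℝ 𝔤]
    (pd : 𝔢 →ₗ⁅ℝ⁆ 𝔤) (act : 𝔤 →ₗ⁅ℝ⁆ LieDerivation ℝ 𝔢 𝔢)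
    (hequiv : ∀ (X : 𝔤) (v : 𝔢), pd (act X v) = ⁅X, pd v⁆)
    (hpeiffer : ∀ u v : 𝔢, act (pd u) v = ⁅u, v⁆)
    (X Y : 𝔤) (s t : 𝔤 →ₗ[ℝ] 𝔢)
    (hs : ∀ Z W : 𝔤, s ⁅Z, W⁆ = act Z (s W) - act W (s Z))
    (ht : ∀ Z W : 𝔤, t ⁅Z, W⁆ = act Z (t W) - act W (t Z)) :
    -- first component of the Peiffer commutator: [X,Y] − f₁(Y) = −∂(s(Y))
    (⁅X, Y⁆ - (⁅X, Y⁆ + pd (s Y)) = -(pd (s Y))) ∧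
    -- second component: ((X ▷ t − Y ▷ s + [s,t]) − (f₂ ∘ t − t ∘ f₁))(Z) = −Z ▷ s(Y)
    (∀ Z : 𝔤,
      ((act X (t Z) - t ⁅X, Z⁆) - (act Y (s Z) - s ⁅Y, Z⁆) +
          (s (pd (t Z)) - t (pd (s Z)))) -
        ((act X (t Z) + s (pd (t Z))) - t (⁅X, Z⁆ + pd (s Z))) =
      -(act Z (s Y))) := by
  refine ⟨by abel, fun Z => ?_⟩
  rw [map_add, hs Y Z]
  abel
end
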